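/- Starting from a configuration with no bad nodes, no execution can perform an infinite number of swaps: in any execution whose initial configuration contains no bad nodes, the total number of swap actions performed (summed over all steps and all activated nodes) is finite. -/

import Mathlib

open scoped Classical

/-- A pre-configuration: a finite node set `V` with a partial parent map
(`none` means the node has no parent) and an integer height assignment. -/
structure PreConfig (V : Type*) where
  parent : V → Option V
  height : V → ℤ

namespace PreConfig

variable {V : Type*} [Fintype V] [LinearOrder V]

/-- The children of `u` are the nodes whose parent is `u`. -/
noncomputable def children (C : PreConfig V) (u : V) : Finset V :=
  Finset.univ.filter (fun v => C.parent v = some u)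

/-- A leaf is a node with no children. -/
def IsLeaf (C : PreConfig V) (u : V) : Prop := C.children u = ∅

/-- Maximum height value among the children of `u` (junk value `0` for a leaf). -/
noncomputable def maxH (C : PreConfig V) (u : V) : ℤ :=
  if h : (C.children u).Nonempty then (C.children u).sup' h C.height else 0

/-- Minimum height value among the children of `u` (junk value `0` for a leaf). -/
noncomputable def minH (C : PreConfig V) (u : V) : ℤ :=
  if h : (C.children u).Nonempty then (C.children u).inf' h C.height else 0

/-- A child of `u` of maximum height value; ties broken by a fixed rule
(smallest ID). Junk value `u` for a leaf. -/
noncomputable def maxChild (C : PreConfig V) (u : V) : V :=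
  if h : ((C.children u).filter fun v => C.height v = C.maxH u).Nonempty
  then ((C.children u).filter fun v => C.height v = C.maxH u).min' h else u

/-- A child of `u` of minimum height value; ties broken by a fixed rule
(smallest ID). Junk value `u` for a leaf. -/
noncomputable def minChild (C : PreConfig V) (u : V) : V :=
  if h : ((C.children u).filter fun v => C.height v = C.minH u).Nonempty
  then ((C.children u).filter fun v => C.height v = C.minH u).min' h else u

/-- `stable(u)`: `h(u) = 0` if `u` is a leaf, and `h(u) = 1 + max_{w child of u} h(w)` otherwise. -/
def Stable (C : PreConfig V) (u : V) : Prop :=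
  (C.IsLeaf u ∧ C.height u = 0) ∨ (¬ C.IsLeaf u ∧ C.height u = 1 + C.maxH u)

/-- `balanced(u)`: `|h(z) − h(z')| ≤ α` for all children `z, z'` of `u`. -/
def Balanced (α : ℤ) (C : PreConfig V) (u : V) : Prop :=
  ∀ z ∈ C.children u, ∀ z' ∈ C.children u, |C.height z - C.height z'| ≤ α

/-- `u` is enabled for a height update iff `¬stable(u)`. -/
def UpdateEnabled (C : PreConfig V) (u : V) : Prop := ¬ C.Stable u

/-- `u` is enabled for a swap iff `stable(u) ∧ stable(max(u)) ∧ ¬balanced(u)`. -/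
def SwapEnabled (α : ℤ) (C : PreConfig V) (u : V) : Prop :=
  C.Stable u ∧ C.Stable (C.maxChild u) ∧ ¬ Balanced α C u

/-- `u` is enabled iff it is enabled for a height update or for a swap. -/
def Enabled (α : ℤ) (C : PreConfig V) (u : V) : Prop :=
  C.UpdateEnabled u ∨ SwapEnabled α C u

/-- The value written by a height update: `0` for a leaf, `1 + max_{w child of u} h(w)` otherwise. -/
noncomputable def newHeight (C : PreConfig V) (u : V) : ℤ :=
  if C.IsLeaf u then 0 else 1 + C.maxH u

/-- A bad node: an internal node `u` with `h(u) ≤ max_{v child of u} h(v)`,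
or a leaf `u` with `h(u) < 0`. -/
def Bad (C : PreConfig V) (u : V) : Prop :=
  (¬ C.IsLeaf u ∧ C.height u ≤ C.maxH u) ∨ (C.IsLeaf u ∧ C.height u < 0)

/-- `v` reaches `a` by iterating the parent map. -/
def Reaches (C : PreConfig V) (v a : V) : Prop :=
  Relation.ReflTransGen (fun x y => C.parent x = some y) v a

/-- The underlying graph is a rooted tree with root `r`: `r` has no parent,
every other node has a (unique) parent, and every node reaches `r` by
iterating the parent map. -/
def IsTree (C : PreConfig V) (r : V) : Prop :=
  C.parent r = none ∧ (∀ v, C.parent v = none → v = r) ∧ ∀ v, C.Reaches v r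

/-- The subtree `S_u` of `u`: the set of descendants of `u` (including `u`). -/
def subtree (C : PreConfig V) (u : V) : Set V := {v | C.Reaches v u}

/-- The actual height `h*(u)` of `u`: the length of a longest directed path
going downward from `u` (such a maximal path necessarily ends at a leaf of `S_u`). -/
noncomputable def hstar (C : PreConfig V) (u : V) : ℕ :=
  sSup {n : ℕ | ∃ f : ℕ → V, f 0 = u ∧ ∀ i < n, C.parent (f (i + 1)) = some (f i)}

/-- An execution step `C →_A C'`: a nonempty set `A` of nodes enabled in `C` is
activated simultaneously; each `u ∈ A` enabled for a height update sets its height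
to `newHeight`; each `u ∈ A` enabled for a swap replaces the edges `(u, min(u))` and
`(max(u), max(max(u)))` by `(u, max(max(u)))` and `(max(u), min(u))` (all guards and
functions evaluated in `C`); everything else is unchanged. -/
structure Step (α : ℤ) (C C' : PreConfig V) (A : Finset V) : Prop where
  nonempty : A.Nonempty
  all_enabled : ∀ u ∈ A, Enabled α C u
  height_update : ∀ u ∈ A, C.UpdateEnabled u → C'.height u = C.newHeight u
  height_keep : ∀ u, ¬ (u ∈ A ∧ C.UpdateEnabled u) → C'.height u = C.height u
  swap_out : ∀ u ∈ A, SwapEnabled α C u → C'.parent (C.minChild u) = some (C.maxChild u)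
  swap_in : ∀ u ∈ A, SwapEnabled α C u → C'.parent (C.maxChild (C.maxChild u)) = some u
  parent_keep : ∀ v, (∀ u ∈ A, SwapEnabled α C u →
      v ≠ C.minChild u ∧ v ≠ C.maxChild (C.maxChild u)) → C'.parent v = C.parent v

end PreConfig

namespace PreConfig

/-- The height of the parent of `v`, or `0` if `v` has no parent. -/
def parentHeight {V : Type*} (C : PreConfig V) (v : V) : ℤ := (C.parent v).elim 0 C.height

theorem parentHeight_eq {V : Type*} {C : PreConfig V} {u v : V}
    (h : C.parent v = some u) : C.parentHeight v = C.height u := by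
  simp [parentHeight, h]

section NoBad

variable {V : Type*} [Fintype V] [LinearOrder V] {C C' : PreConfig V} {A : Finset V} {α : ℤ}

theorem mem_children {u v : V} : v ∈ C.children u ↔ C.parent v = some u := by
  simp [children]

theorem not_isLeaf_of_parent {u v : V} (h : C.parent v = some u) : ¬ C.IsLeaf u := fun hl =>
  Finset.eq_empty_iff_forall_notMem.mp hl v (mem_children.mpr h)

theorem height_le_maxH {u v : V} (h : C.parent v = some u) : C.height v ≤ C.maxH u := by
  have hv := mem_children.mpr h
  rw [maxH, dif_pos ⟨v, hv⟩]
  exact Finset.le_sup' C.height hv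

theorem minH_le_height {u v : V} (h : C.parent v = some u) : C.minH u ≤ C.height v := by
  have hv := mem_children.mpr h
  rw [minH, dif_pos ⟨v, hv⟩]
  exact Finset.inf'_le C.height hv

theorem maxChild_spec {u : V} (h : ¬ C.IsLeaf u) :
    C.parent (C.maxChild u) = some u ∧ C.height (C.maxChild u) = C.maxH u := by
  have hne : (C.children u).Nonempty := Finset.nonempty_iff_ne_empty.mpr h
  have hf : ((C.children u).filter fun v => C.height v = C.maxH u).Nonempty := by
    obtain ⟨v, hv, hv'⟩ := Finset.exists_mem_eq_sup' hne C.height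
    refine ⟨v, Finset.mem_filter.mpr ⟨hv, ?_⟩⟩
    rw [maxH, dif_pos hne, hv']
  have hm := Finset.min'_mem _ hf
  rw [maxChild, dif_pos hf]
  exact ⟨mem_children.mp (Finset.mem_filter.mp hm).1, (Finset.mem_filter.mp hm).2⟩

theorem minChild_spec {u : V} (h : ¬ C.IsLeaf u) :
    C.parent (C.minChild u) = some u ∧ C.height (C.minChild u) = C.minH u := by
  have hne : (C.children u).Nonempty := Finset.nonempty_iff_ne_empty.mpr h
  have hf : ((C.children u).filter fun v => C.height v = C.minH u).Nonempty := by
    obtain ⟨v, hv, hv'⟩ := Finset.exists_mem_eq_inf' hne C.height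
    refine ⟨v, Finset.mem_filter.mpr ⟨hv, ?_⟩⟩
    rw [minH, dif_pos hne, hv']
  have hm := Finset.min'_mem _ hf
  rw [minChild, dif_pos hf]
  exact ⟨mem_children.mp (Finset.mem_filter.mp hm).1, (Finset.mem_filter.mp hm).2⟩

/-- Heights are nonnegative and strictly increase along parent edges; this is implied by the
absence of bad nodes. -/
structure Graded (C : PreConfig V) : Prop where
  lt_of_parent : ∀ {u v : V}, C.parent v = some u → C.height v < C.height u
  nonneg : ∀ u, 0 ≤ C.height u

theorem Graded.of_forall_not_bad (hC : ∀ u, ¬ C.Bad u) : C.Graded := by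
  have hlt : ∀ {u v : V}, C.parent v = some u → C.height v < C.height u := fun {u v} h => by
    by_contra hle
    exact hC u (Or.inl ⟨not_isLeaf_of_parent h, (not_lt.mp hle).trans (height_le_maxH h)⟩)
  refine ⟨hlt, fun u => ?_⟩
  have : Nonempty V := ⟨u⟩
  obtain ⟨m, hm⟩ := Finite.exists_min C.height
  refine le_trans ?_ (hm u)
  by_cases hl : C.IsLeaf m
  · by_contra hneg
    exact hC m (Or.inr ⟨hl, not_le.mp hneg⟩)
  · exact absurd (hm (C.maxChild m)) (not_le.mpr (hlt (maxChild_spec hl).1))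

/-- The grandchild of `u` that a swap at `u` lifts to a child of `u`. -/
noncomputable abbrev grandMaxChild (C : PreConfig V) (u : V) : V := C.maxChild (C.maxChild u)

/-- The shape of the neighbourhood of a node enabled for a swap. -/
structure SwapShape (C : PreConfig V) (u : V) : Prop where
  parent_max : C.parent (C.maxChild u) = some u
  parent_min : C.parent (C.minChild u) = some u
  parent_grand : C.parent (C.grandMaxChild u) = some (C.maxChild u)
  height_eq : C.height u = C.height (C.maxChild u) + 1
  height_max : C.height (C.maxChild u) = C.height (C.grandMaxChild u) + 1
  height_min : C.height (C.minChild u) + 2 ≤ C.height (C.maxChild u)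

theorem SwapEnabled.shape (hα : 1 ≤ α) (hC : C.Graded) {u : V} (h : SwapEnabled α C u) :
    C.SwapShape u := by
  obtain ⟨hu, hv, hb⟩ := h
  simp only [Balanced, not_forall, not_le] at hb
  obtain ⟨z, hz, z', hz', hd⟩ := hb
  rw [mem_children] at hz hz'
  have hl := not_isLeaf_of_parent hz
  obtain ⟨hpM, hhM⟩ := maxChild_spec hl
  obtain ⟨hpm, hhm⟩ := minChild_spec hl
  have h1 := height_le_maxH hz
  have h2 := height_le_maxH hz'
  have h3 := minH_le_height hz
  have h4 := minH_le_height hz'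
  have h5 : C.minH u + 2 ≤ C.maxH u := by
    rcases lt_abs.mp hd with hd | hd <;> omega
  have h6 := hC.nonneg (C.minChild u)
  have hv' : ¬ C.IsLeaf (C.maxChild u) ∧
      C.height (C.maxChild u) = 1 + C.maxH (C.maxChild u) := by
    rcases hv with hv | hv
    · omega
    · exact hv
  have hu' : C.height u = 1 + C.maxH u := by
    rcases hu with hu | hu
    · exact absurd hu.1 hl
    · exact hu.2
  obtain ⟨hpx, hhx⟩ := maxChild_spec hv'.1
  refine ⟨hpM, hpm, hpx, by omega, ?_, by omega⟩
  rw [hv'.2, ← hhx, add_comm]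

theorem newHeight_lt (hC : C.Graded) {u : V} (hu : C.UpdateEnabled u) :
    C.newHeight u < C.height u := by
  unfold UpdateEnabled Stable at hu
  unfold newHeight
  split_ifs with hl
  · have := hC.nonneg u
    have : C.height u ≠ 0 := fun h => hu (Or.inl ⟨hl, h⟩)
    omega
  · have := hC.lt_of_parent (maxChild_spec hl).1
    rw [(maxChild_spec hl).2] at this
    have : C.height u ≠ 1 + C.maxH u := fun h => hu (Or.inr ⟨hl, h⟩)
    omega

theorem Step.height_le (hs : Step α C C' A) (hC : C.Graded) (u : V) :
    C'.height u ≤ C.height u := by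
  by_cases h : u ∈ A ∧ C.UpdateEnabled u
  · rw [hs.height_update u h.1 h.2]
    exact (newHeight_lt hC h.2).le
  · exact (hs.height_keep u h).le

theorem Step.height_eq_of_stable (hs : Step α C C' A) {u : V} (hu : C.Stable u) :
    C'.height u = C.height u :=
  hs.height_keep u fun h => h.2 hu

theorem Step.parent_cases (hs : Step α C C' A) (v : V) :
    C'.parent v = C.parent v ∨ ∃ u ∈ A, SwapEnabled α C u ∧
      ((v = C.minChild u ∧ C'.parent v = some (C.maxChild u)) ∨
        (v = C.grandMaxChild u ∧ C'.parent v = some u)) := by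
  by_cases h : ∀ u ∈ A, SwapEnabled α C u → v ≠ C.minChild u ∧ v ≠ C.maxChild (C.maxChild u)
  · exact Or.inl (hs.parent_keep v h)
  · push Not at h
    obtain ⟨u, hu, hsw, hv⟩ := h
    refine Or.inr ⟨u, hu, hsw, ?_⟩
    by_cases hm : v = C.minChild u
    · exact Or.inl ⟨hm, hm ▸ hs.swap_out u hu hsw⟩
    · exact Or.inr ⟨hv hm, hv hm ▸ hs.swap_in u hu hsw⟩

theorem Step.graded (hα : 1 ≤ α) (hs : Step α C C' A) (hC : C.Graded) : C'.Graded := by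
  refine ⟨fun {u v} h => ?_, fun u => ?_⟩
  · have hv := hs.height_le hC v
    rcases hs.parent_cases v with hk | ⟨a, -, hsw, ⟨rfl, hp⟩ | ⟨rfl, hp⟩⟩
    · rw [hk] at h
      by_cases hu : u ∈ A ∧ C.UpdateEnabled u
      · rw [hs.height_update u hu.1 hu.2, newHeight, if_neg (not_isLeaf_of_parent h)]
        have := height_le_maxH h
        omega
      · rw [hs.height_keep u hu]
        exact hv.trans_lt (hC.lt_of_parent h)
    · have sh := hsw.shape hα hC
      obtain rfl : C.maxChild a = u := Option.some.inj (hp.symm.trans h)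
      rw [hs.height_eq_of_stable hsw.2.1]
      have := sh.height_min
      omega
    · have sh := hsw.shape hα hC
      obtain rfl : a = u := Option.some.inj (hp.symm.trans h)
      rw [hs.height_eq_of_stable hsw.1]
      have := sh.height_eq
      have := sh.height_max
      omega
  · by_cases hu : u ∈ A ∧ C.UpdateEnabled u
    · rw [hs.height_update u hu.1 hu.2, newHeight]
      split_ifs with hl
      · exact le_rfl
      · have := hC.nonneg (C.maxChild u)
        rw [(maxChild_spec hl).2] at this
        omega
    · rw [hs.height_keep u hu]
      exact hC.nonneg u

/-- A potential that increases with every step in which all activated nodes swap. -/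
def potential (C : PreConfig V) : ℤ := ∑ v, C.height v * C.parentHeight v

theorem Step.potential_lt (hα : 1 ≤ α) (hs : Step α C C' A) (hC : C.Graded)
    (hh : C'.height = C.height) : C.potential < C'.potential := by
  have hsw : ∀ u ∈ A, SwapEnabled α C u := fun u hu => by
    refine (hs.all_enabled u hu).resolve_left fun hup => ?_
    have := newHeight_lt hC hup
    rw [← hs.height_update u hu hup, hh] at this
    exact lt_irrefl _ this
  have sh : ∀ u ∈ A, C.SwapShape u := fun u hu => (hsw u hu).shape hα hC
  let g : V → ℤ := fun v => C.height v * (C'.parentHeight v - C.parentHeight v)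
  have hg : C'.potential - C.potential = ∑ v, g v := by
    simp only [potential, hh, ← Finset.sum_sub_distrib, g, mul_sub]
  have hinj₁ : Set.InjOn C.minChild A := fun a ha b hb hab => by
    have := (sh a ha).parent_min
    rw [hab, (sh b hb).parent_min] at this
    exact (Option.some.inj this).symm
  have hinj₂ : Set.InjOn C.grandMaxChild A := fun a ha b hb hab => by
    have h := (sh a ha).parent_grand
    rw [hab, (sh b hb).parent_grand] at h
    have h' := (sh a ha).parent_max
    rw [← Option.some.inj h, (sh b hb).parent_max] at h'
    exact (Option.some.inj h').symm
  have hdisj : Disjoint (A.image C.minChild) (A.image C.grandMaxChild) := by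
    rw [Finset.disjoint_left]
    intro v hv hv'
    obtain ⟨a, ha, rfl⟩ := Finset.mem_image.mp hv
    obtain ⟨b, hb, hab⟩ := Finset.mem_image.mp hv'
    have h := (sh b hb).parent_grand
    rw [hab, (sh a ha).parent_min] at h
    have h' := (sh a ha).height_min
    rw [Option.some.inj h] at h'
    have hab' : C.maxChild (C.maxChild b) = C.minChild a := hab
    rw [hab', ← Option.some.inj h] at h'
    omega
  have hsum : ∑ v, g v = ∑ u ∈ A, (g (C.minChild u) + g (C.grandMaxChild u)) := by
    rw [Finset.sum_add_distrib, ← Finset.sum_image hinj₁, ← Finset.sum_image hinj₂,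
      ← Finset.sum_union hdisj]
    refine (Finset.sum_subset (Finset.subset_univ _) fun v _ hv => ?_).symm
    have hp : C'.parent v = C.parent v := by
      refine hs.parent_keep v fun u hu _ => ⟨?_, ?_⟩ <;> rintro rfl <;> apply hv
      · exact Finset.mem_union_left _ (Finset.mem_image_of_mem _ hu)
      · exact Finset.mem_union_right _ (Finset.mem_image_of_mem C.grandMaxChild hu)
    simp [g, parentHeight, hp, hh]
  have hpos : 0 < ∑ u ∈ A, (g (C.minChild u) + g (C.grandMaxChild u)) := by
    refine Finset.sum_pos (fun u hu => ?_) hs.nonempty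
    have s := sh u hu
    simp only [g, parentHeight_eq s.parent_min, parentHeight_eq s.parent_grand,
      parentHeight_eq (hs.swap_out u hu (hsw u hu)),
      parentHeight_eq (hs.swap_in u hu (hsw u hu)), hh]
    have h1 := s.height_eq
    have h2 := s.height_max
    have h3 := s.height_min
    rw [h1, add_sub_cancel_left, sub_add_cancel_left]
    omega
  omega

/-- The heights along an infinite execution without bad nodes are eventually constant. -/
theorem exists_height_eventually_eq {Cs : ℕ → PreConfig V} {As : ℕ → Finset V}
    (hstep : ∀ n, Step α (Cs n) (Cs (n + 1)) (As n)) (hC : ∀ n, (Cs n).Graded) :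
    ∃ N, ∀ n, N ≤ n → (Cs n).height = (Cs N).height := by
  let H : ℕ → V → ℕ := fun n v => ((Cs n).height v).toNat
  have hH : Antitone H := antitone_nat_of_succ_le fun n v =>
    Int.toNat_le_toNat ((hstep n).height_le (hC n) v)
  obtain ⟨N, hN⟩ := WellFoundedLT.antitone_chain_condition hH
  refine ⟨N, fun n hn => funext fun v => ?_⟩
  have h : ((Cs N).height v).toNat = ((Cs n).height v).toNat := congrFun (hN n hn) v
  have := (hC n).nonneg v
  have := (hC N).nonneg v
  omega

theorem not_infinite_execution (hα : 1 ≤ α) {Cs : ℕ → PreConfig V} {As : ℕ → Finset V}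
    (hstep : ∀ n, Step α (Cs n) (Cs (n + 1)) (As n)) (hbad : ∀ u, ¬ (Cs 0).Bad u) : False := by
  have hC : ∀ n, (Cs n).Graded := fun n => by
    induction n with
    | zero => exact .of_forall_not_bad hbad
    | succ n ih => exact (hstep n).graded hα ih
  obtain ⟨N, hN⟩ := exists_height_eventually_eq hstep hC
  have hmono : StrictMono fun n => (Cs (N + n)).potential := strictMono_nat_of_lt_succ fun n =>
    (hstep (N + n)).potential_lt hα (hC _)
      ((hN (N + n + 1) (by omega)).trans (hN (N + n) (by omega)).symm)
  refine not_injective_infinite_finite (fun n => (Cs (N + n)).parent) fun m n hmn => ?_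
  refine hmono.injective ?_
  have hm := hN (N + m) (by omega)
  have hn := hN (N + n) (by omega)
  have hmn' : (Cs (N + m)).parent = (Cs (N + n)).parent := hmn
  simp only [potential, parentHeight, hm, hn, hmn']

end NoBad

end PreConfig

/-- In any execution whose initial configuration contains no bad nodes,
the total number of swap actions performed (summed over all steps and all activated
nodes) is finite. -/
theorem stmt5 {V : Type*} [Fintype V] [LinearOrder V] (α : ℤ) (hα : 1 ≤ α)
    (Cs : ℕ → PreConfig V) (As : ℕ → Finset V) (r : V)
    (hT : (Cs 0).IsTree r)
    (hstep : ∀ n, PreConfig.Step α (Cs n) (Cs (n + 1)) (As n))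
    (hbad : ∀ u, ¬ (Cs 0).Bad u) :
    {p : ℕ × V | p.2 ∈ As p.1 ∧ PreConfig.SwapEnabled α (Cs p.1) p.2}.Finite := by
  exact (PreConfig.not_infinite_execution hα hstep hbad).elim
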